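/- arXiv:1011.0171 — 2 statements merged into one kernel-verified Lean document; each statement's English description precedes it below -/
import Mathlib

section
/- (Positivity of the fractional dissipation.) Let 0 < α < 1 and 2 ≤ q < ∞. For any sufficiently smooth and decaying function f on ℝ^d (e.g., f Schwartz, or f = Δ_j θ for a Schwartz function θ, including j = −1), ∫_{ℝ^d} f · |f|^{q−2} · (−Δ)^α f dx ≥ 0. -/
open MeasureTheory Filter Complex
open scoped ENNReal Topology FourierTransform

noncomputable section

/-- The underlying Euclidean space `ℝ^d`. -/
abbrev Spc (d : ℕ) := EuclideanSpace ℝ (Fin d)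

/-- The partial derivative `∂_i f` of a scalar function. -/
def pd {d : ℕ} (i : Fin d) (f : Spc d → ℝ) : Spc d → ℝ :=
  fun x => fderiv ℝ f x (EuclideanSpace.single i 1)

/-- Fourier multiplier operator with symbol `m`, acting on real-valued functions:
`(fm m f)^(ξ) = m(ξ) f̂(ξ)`. -/
def fm {d : ℕ} (m : Spc d → ℂ) (f : Spc d → ℝ) : Spc d → ℝ :=
  fun x => (𝓕⁻ (fun ξ => m ξ * 𝓕 (fun y => (f y : ℂ)) ξ) x).re

/-- The fractional Laplacian `(−Δ)^α`, with Fourier symbol `|ξ|^{2α}`. -/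
def fracLap {d : ℕ} (α : ℝ) : (Spc d → ℝ) → Spc d → ℝ :=
  fm (fun ξ => ((‖ξ‖ ^ (2 * α) : ℝ) : ℂ))

/-- The operator `Λ^s = (−Δ)^{s/2}`, with Fourier symbol `|ξ|^s`. -/
def lamPow {d : ℕ} (s : ℝ) : (Spc d → ℝ) → Spc d → ℝ :=
  fm (fun ξ => ((‖ξ‖ ^ s : ℝ) : ℂ))

/-- The Riesz transform `R_l`, with Fourier symbol `i ξ_l / |ξ|`. -/
def rieszT {d : ℕ} (l : Fin d) : (Spc d → ℝ) → Spc d → ℝ :=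
  fm (fun ξ => Complex.I * (ξ l : ℂ) / (‖ξ‖ : ℂ))

/-- The operator `P(Λ)` for a radial symbol `P`. -/
def PLam {d : ℕ} (P : ℝ → ℝ) : (Spc d → ℝ) → Spc d → ℝ :=
  fm (fun ξ => ((P ‖ξ‖ : ℝ) : ℂ))

/-- The Laplacian of a scalar function. -/
def lapOp {d : ℕ} (g : Spc d → ℝ) : Spc d → ℝ :=
  fun x => ∑ i, pd i (pd i g) x

/-- The iterated operator `(I − Δ)^n`. -/
def IminusLapPow {d : ℕ} : ℕ → (Spc d → ℝ) → (Spc d → ℝ)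
  | 0, g => g
  | n + 1, g => IminusLapPow n g - lapOp (IminusLapPow n g)

/-- Condition 1.1 on the radial symbol `P`, with constants `C` and `C₀`. -/
structure SymbolCondition (d : ℕ) (P : ℝ → ℝ) (C C₀ : ℝ) : Prop where
  nonneg : ∀ t, 0 ≤ P t
  cont : Continuous (fun ξ : Spc d => P ‖ξ‖)
  smooth : ContDiffOn ℝ (⊤ : ℕ∞) (fun ξ : Spc d => P ‖ξ‖) {ξ | ξ ≠ 0}
  mono : MonotoneOn P (Set.Ici (0 : ℝ))
  deriv_bound : ∀ (j : ℤ) (n : ℕ), 1 ≤ n → n ≤ 1 + d / 2 →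
    ∀ η : Spc d, 2⁻¹ ≤ ‖η‖ → ‖η‖ ≤ 2 →
      |IminusLapPow n (fun ξ => P ((2 : ℝ) ^ j * ‖ξ‖)) η| ≤ C * P (C₀ * (2 : ℝ) ^ j)

/-- Data for a standard inhomogeneous Littlewood–Paley decomposition: a smooth
low-frequency cutoff `χ` supported in the unit ball and a smooth bump `φ`
supported in the annulus `{1/2 ≤ |ξ| ≤ 2}` forming a dyadic partition of unity. -/
structure LPData (d : ℕ) where
  χ : Spc d → ℝ
  φ : Spc d → ℝ
  χ_smooth : ContDiff ℝ (⊤ : ℕ∞) χ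
  φ_smooth : ContDiff ℝ (⊤ : ℕ∞) φ
  χ_supp : ∀ ξ : Spc d, 1 < ‖ξ‖ → χ ξ = 0
  φ_supp : ∀ ξ : Spc d, φ ξ ≠ 0 → 2⁻¹ ≤ ‖ξ‖ ∧ ‖ξ‖ ≤ 2
  sum_one : ∀ ξ : Spc d, χ ξ + ∑' j : ℕ, φ ((2 : ℝ) ^ (-(j : ℤ)) • ξ) = 1

/-- The Littlewood–Paley (Fourier localization) operator `Δ_j`, `j ≥ −1`. -/
def LPData.Δ {d : ℕ} (D : LPData d) (j : ℤ) : (Spc d → ℝ) → Spc d → ℝ :=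
  if j = -1 then fm (fun ξ => (D.χ ξ : ℂ))
  else if 0 ≤ j then fm (fun ξ => (D.φ ((2 : ℝ) ^ (-j) • ξ) : ℂ))
  else fun _ _ => 0

/-- The partial sum operator `S_N = ∑_{−1 ≤ j ≤ N−1} Δ_j`. -/
def LPData.S {d : ℕ} (D : LPData d) (N : ℤ) (f : Spc d → ℝ) : Spc d → ℝ :=
  fun x => ∑ j ∈ Finset.Icc (-1 : ℤ) (N - 1), D.Δ j f x

/-- The extended Besov norm `‖f‖_{B^{s,A}_{q,∞}} = sup_{j ≥ −1} 2^{s A_j} ‖Δ_j f‖_{L^q}`. -/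
def besovNorm {d : ℕ} (D : LPData d) (s : ℝ) (q : ℝ≥0∞) (A : ℤ → ℝ) (f : Spc d → ℝ) : ℝ≥0∞ :=
  ⨆ j : {j : ℤ // -1 ≤ j}, ENNReal.ofReal ((2 : ℝ) ^ (s * A j.1)) * eLpNorm (D.Δ j.1 f) q volume

/-- The norm of `L¹(ℝ^d) ∩ L^∞(ℝ^d)`. -/
def l1linfNorm {d : ℕ} (f : Spc d → ℝ) : ℝ≥0∞ :=
  max (eLpNorm f 1 volume) (eLpNorm f ∞ volume)

/-- The components of the velocity field of equation (G): `u_j = R_{l(j)} Λ^{−1} P(Λ) θ`. -/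
def uComp {d : ℕ} (P : ℝ → ℝ) (lidx : Fin d → Fin d) (f : Spc d → ℝ) (j : Fin d) :
    Spc d → ℝ :=
  rieszT (lidx j) (lamPow (-1) (PLam P f))

/-- `θ` is a solution of the active scalar equation (G):
`∂_t θ + u·∇θ + κ(−Δ)^α θ = 0` with `u_j = R_{l(j)} Λ^{−1} P(Λ) θ`. -/
def solvesG {d : ℕ} (P : ℝ → ℝ) (κ α : ℝ) (lidx : Fin d → Fin d)
    (θ : ℝ → Spc d → ℝ) : Prop :=
  ∀ t : ℝ, 0 < t → ∀ x : Spc d,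
    HasDerivAt (fun τ => θ τ x)
      (-(∑ i, uComp P lidx (θ t) i x * pd i (θ t) x) - κ * fracLap α (θ t) x) t

/-- The perpendicular gradient `∇^⊥ f = (−∂₂ f, ∂₁ f)` on `ℝ²`. -/
def pgrad (f : Spc 2 → ℝ) (x : Spc 2) : Spc 2 :=
  (WithLp.equiv 2 (Fin 2 → ℝ)).symm ![-(pd 1 f x), pd 0 f x]

/-- `θ` is a solution of the 2D active scalar equation
`∂_t θ + u·∇θ + κ(−Δ)^α θ = 0`, `u = ∇^⊥ψ`, `Δψ = P(Λ)θ`,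
where `P` has radial symbol `Psym`. -/
def solves2D (Psym : ℝ → ℝ) (κ α : ℝ) (θ : ℝ → Spc 2 → ℝ) : Prop :=
  ∃ ψ : ℝ → Spc 2 → ℝ,
    (∀ t : ℝ, 0 ≤ t → ∀ x, lapOp (ψ t) x = PLam Psym (θ t) x) ∧
    ∀ t : ℝ, 0 < t → ∀ x : Spc 2,
      HasDerivAt (fun τ => θ τ x)
        (-(∑ i, pgrad (ψ t) x i * pd i (θ t) x) - κ * fracLap α (θ t) x) t

/-- The inhomogeneous Sobolev `H^m` norm (squared) via the Fourier transform:
`∫ (1+|ξ|²)^m |f̂(ξ)|² dξ`. -/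
def hSobNormSq (m : ℝ) (f : Spc 2 → ℝ) : ℝ≥0∞ :=
  ∫⁻ ξ, ENNReal.ofReal ((1 + ‖ξ‖ ^ 2) ^ m * ‖𝓕 (fun y => (f y : ℂ)) ξ‖ ^ 2)

/-- An `ℝ≥0∞`-valued `L^p` norm of an `ℝ≥0∞`-valued function. -/
def lpNormE {d : ℕ} (p : ℝ≥0∞) (g : Spc d → ℝ≥0∞) : ℝ≥0∞ :=
  if p = ∞ then essSup g volume
  else (∫⁻ x, g x ^ p.toReal) ^ (1 / p.toReal)

/-- The homogeneous Triebel–Lizorkin-type seminorm `‖f‖_{Ḟ^σ_{p,q}}` on `ℝ²`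
(with the usual supremum modification when `q = ∞`). -/
def tlNorm {E : Type*} [NormedAddCommGroup E] (σ : ℝ) (p q : ℝ≥0∞) (f : Spc 2 → E) : ℝ≥0∞ :=
  lpNormE p (fun x =>
    if q = ∞ then ⨆ y : {y : Spc 2 // y ≠ 0}, (‖f (x + y.1) - f x‖₊ : ℝ≥0∞) / (‖y.1‖₊ : ℝ≥0∞) ^ σ
    else (∫⁻ y, (‖f (x + y) - f x‖₊ : ℝ≥0∞) ^ q.toReal /
        (‖y‖₊ : ℝ≥0∞) ^ (2 + σ * q.toReal)) ^ (1 / q.toReal))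

/-- The `L^r` norm in time on `(0,T)` of an `ℝ≥0∞`-valued quantity. -/
def timeLp (r : ℝ≥0∞) (T : ℝ) (g : ℝ → ℝ≥0∞) : ℝ≥0∞ :=
  if r = ∞ then essSup g (volume.restrict (Set.Ioo 0 T))
  else (∫⁻ t in Set.Ioo 0 T, g t ^ r.toReal) ^ (1 / r.toReal)

/-- The direction field `ξ = ∇^⊥θ / |∇^⊥θ|`. -/
def dirField (f : Spc 2 → ℝ) : Spc 2 → Spc 2 :=
  fun x => (‖pgrad f x‖)⁻¹ • pgrad f x

/-- Principal-value integral over `ℝ²`: the limit as `ε → 0⁺` of the integrals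
over `{|y| > ε}`. -/
def pvIntegral (F : Spc 2 → ℝ) : ℝ :=
  limUnder (𝓝[>] (0 : ℝ)) (fun ε => ∫ y in {y : Spc 2 | ε < ‖y‖}, F y)

end
open scoped RealInnerProductSpace SchwartzMap

section Positivity

lemma mul_abs_rpow_sub_mul_sub_nonneg {p : ℝ} (hp : 0 ≤ p) (a b : ℝ) :
    0 ≤ (a * |a| ^ p - b * |b| ^ p) * (a - b) := by
  wlog h : |b| ≤ |a| generalizing a b
  · have := this b a (le_of_not_ge h)
    linarith
  have hAB : |b| ^ p ≤ |a| ^ p := Real.rpow_le_rpow (abs_nonneg b) h hp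
  have hB : 0 ≤ |b| ^ p := Real.rpow_nonneg (abs_nonneg b) p
  have hab : 0 ≤ a * (a - b) := by
    have h1 : a * b ≤ |a| * |b| := (le_abs_self _).trans (abs_mul a b).le
    nlinarith [abs_mul_abs_self a, mul_le_mul_of_nonneg_left h (abs_nonneg a)]
  nlinarith [mul_nonneg hB (sq_nonneg (a - b)), mul_nonneg (sub_nonneg.2 hAB) hab]

variable {V : Type*} [NormedAddCommGroup V] [InnerProductSpace ℝ V] [FiniteDimensional ℝ V]
  [MeasurableSpace V] [BorelSpace V]

lemma continuous_fourierInv_of_integrable {ψ : V → ℂ} (hψ : Integrable ψ) :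
    Continuous (𝓕⁻ ψ) := by
  have h : Continuous (𝓕 ψ) :=
    VectorFourier.fourierIntegral_continuous Real.continuous_fourierChar
      (innerSL ℝ).continuous₂ hψ
  have : 𝓕⁻ ψ = fun x => 𝓕 ψ (-x) := funext fun x => Real.fourierInv_eq_fourier_neg ψ x
  rw [this]
  exact h.comp continuous_neg

lemma norm_fourierInv_le_integral_norm (ψ : V → ℂ) (ξ : V) : ‖𝓕⁻ ψ ξ‖ ≤ ∫ x, ‖ψ x‖ := by
  rw [Real.fourierInv_eq]
  refine (norm_integral_le_integral_norm _).trans (le_of_eq ?_)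
  simp [Circle.norm_smul]

lemma integral_mul_fourierInv_eq {ψ F : V → ℂ} (hψ : Integrable ψ) (hF : Integrable F) :
    ∫ x, ψ x * 𝓕⁻ F x = ∫ ξ, 𝓕⁻ ψ ξ * F ξ := by
  have h := VectorFourier.integral_fourierIntegral_smul_eq_flip (L := -innerₗ V)
    (μ := volume) (ν := volume) Real.continuous_fourierChar
    (continuous_inner (𝕜 := ℝ) (E := V)).neg hψ hF
  have hL : (-innerₗ V).flip = -innerₗ V := by
    ext x y
    simp [real_inner_comm]
  rw [hL] at h
  exact h.symm

lemma integral_mul_second_difference_nonneg {g : ℝ → ℝ}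
    (hg : ∀ a b, 0 ≤ (g a - g b) * (a - b)) {f : V → ℝ} (hf : Continuous f) {C : ℝ}
    (hC : ∀ x, ‖f x‖ ≤ C) (hgf : Integrable (fun x => g (f x))) (z : V) :
    0 ≤ ∫ x, g (f x) * (f x - (f (x + z) + f (x - z)) / 2) := by
  have hint (u w : V) : Integrable (fun x => g (f (x + u)) * f (x + w)) :=
    (hgf.comp_add_right u).mul_bdd (hf.comp (continuous_add_const w)).aestronglyMeasurable
      (.of_forall fun x => hC _)
  have h00 := hint 0 0
  have h0z := hint 0 z
  have h0z' := hint 0 (-z)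
  have hzz := hint z z
  have hz0 := hint z 0
  simp only [add_zero, ← sub_eq_add_neg] at h00 h0z h0z' hzz hz0
  have e1 : ∫ x, g (f (x + z)) * f (x + z) = ∫ x, g (f x) * f x :=
    integral_add_right_eq_self (fun x => g (f x) * f x) z
  have e2 : ∫ x, g (f (x + z)) * f x = ∫ x, g (f x) * f (x - z) := by
    simpa using integral_add_right_eq_self (fun x => g (f x) * f (x - z)) z
  have h0 : 0 ≤ ∫ x, (g (f x) - g (f (x + z))) * (f x - f (x + z)) :=
    integral_nonneg fun x => hg _ _
  have e3 : ∫ x, (g (f x) - g (f (x + z))) * (f x - f (x + z))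
      = (∫ x, g (f x) * f x) - (∫ x, g (f x) * f (x + z)) - (∫ x, g (f (x + z)) * f x)
        + ∫ x, g (f (x + z)) * f (x + z) := by
    have h1 : Integrable fun x => g (f x) * f x - g (f x) * f (x + z) := h00.sub h0z
    have h2 : Integrable fun x => g (f x) * f x - g (f x) * f (x + z) - g (f (x + z)) * f x :=
      h1.sub hz0
    rw [← integral_sub h00 h0z, ← integral_sub h1 hz0, ← integral_add h2 hzz]
    congr 1 with x
    ring
  have e4 : ∫ x, g (f x) * (f x - (f (x + z) + f (x - z)) / 2)
      = (∫ x, g (f x) * f x) - ((∫ x, g (f x) * f (x + z)) + ∫ x, g (f x) * f (x - z)) / 2 := by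
    have h1 : Integrable fun x => (g (f x) * f (x + z) + g (f x) * f (x - z)) / 2 :=
      (h0z.add h0z').div_const 2
    rw [← integral_add h0z h0z', ← integral_div, ← integral_sub h00 h1]
    congr 1 with x
    ring
  rw [e4]
  rw [e3, e1, e2] at h0
  linarith

lemma fourierInv_one_sub_cos_mul_fourier {f : V → ℂ} (hf : Continuous f) (hfi : Integrable f)
    (hFi : Integrable (𝓕 f)) (z x : V) :
    𝓕⁻ (fun ξ => ((1 - Real.cos (2 * Real.pi * ⟪ξ, z⟫) : ℝ) : ℂ) * 𝓕 f ξ) x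
      = f x - (f (x + z) + f (x - z)) / 2 := by
  have key (y : V) : ∫ ξ, Complex.exp (↑(2 * Real.pi * ⟪ξ, y⟫) * I) * 𝓕 f ξ = f y := by
    have := congrFun (hf.fourierInv_fourier_eq hfi hFi) y
    rw [Real.fourierInv_eq'] at this
    simpa only [smul_eq_mul] using this
  have hi (y : V) : Integrable fun ξ => Complex.exp (↑(2 * Real.pi * ⟪ξ, y⟫) * I) * 𝓕 f ξ :=
    hFi.bdd_mul (c := 1) (Continuous.aestronglyMeasurable (by fun_prop))
      (.of_forall fun ξ => (Complex.norm_exp_ofReal_mul_I _).le)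
  have hi' : Integrable fun ξ => (Complex.exp (↑(2 * Real.pi * ⟪ξ, x + z⟫) * I) * 𝓕 f ξ
      + Complex.exp (↑(2 * Real.pi * ⟪ξ, x - z⟫) * I) * 𝓕 f ξ) / 2 :=
    ((hi _).add (hi _)).div_const 2
  rw [Real.fourierInv_eq', ← key x, ← key (x + z), ← key (x - z),
    ← integral_add (hi _) (hi _), ← integral_div, ← integral_sub (hi _) hi']
  congr 1 with ξ
  have e1 : Complex.exp (↑(2 * Real.pi * ⟪ξ, x + z⟫) * I)
      = Complex.exp (↑(2 * Real.pi * ⟪ξ, x⟫) * I) * Complex.exp (↑(2 * Real.pi * ⟪ξ, z⟫) * I) := by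
    rw [← Complex.exp_add, inner_add_right]
    push_cast
    ring_nf
  have e2 : Complex.exp (↑(2 * Real.pi * ⟪ξ, x - z⟫) * I)
      = Complex.exp (↑(2 * Real.pi * ⟪ξ, x⟫) * I)
        * Complex.exp (-↑(2 * Real.pi * ⟪ξ, z⟫) * I) := by
    rw [← Complex.exp_add, inner_sub_right]
    push_cast
    ring_nf
  rw [e1, e2, Complex.ofReal_sub, Complex.ofReal_one, Complex.ofReal_cos, Complex.cos, smul_eq_mul]
  ring

lemma integral_one_sub_cos_mul_nonneg {g : ℝ → ℝ} (hg : ∀ a b, 0 ≤ (g a - g b) * (a - b))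
    (f : 𝓢(V, ℝ)) (hgf : Integrable (fun x => g (f x)))
    (hFi : Integrable (𝓕 (fun x => (f x : ℂ)))) (z : V) :
    0 ≤ ∫ ξ, (1 - Real.cos (2 * Real.pi * ⟪ξ, z⟫)) *
      (𝓕⁻ (fun x => (g (f x) : ℂ)) ξ * 𝓕 (fun x => (f x : ℂ)) ξ).re := by
  have hC (x : V) : ‖f x‖ ≤ SchwartzMap.seminorm ℝ 0 0 f := SchwartzMap.norm_le_seminorm ℝ f x
  have h := integral_mul_second_difference_nonneg hg f.continuous hC hgf z
  have hgi : Integrable (fun x => (g (f x) : ℂ)) := hgf.ofReal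
  have hmi : Integrable (fun ξ => ((1 - Real.cos (2 * Real.pi * ⟪ξ, z⟫) : ℝ) : ℂ) *
      𝓕 (fun x => (f x : ℂ)) ξ) := by
    refine hFi.bdd_mul (c := 2) (Continuous.aestronglyMeasurable (by fun_prop))
      (.of_forall fun ξ => ?_)
    rw [Complex.norm_real, Real.norm_eq_abs, abs_le]
    constructor <;> linarith [Real.neg_one_le_cos (2 * Real.pi * ⟪ξ, z⟫),
      Real.cos_le_one (2 * Real.pi * ⟪ξ, z⟫)]
  have hmul := integral_mul_fourierInv_eq hgi hmi
  have hfc : Continuous fun x => (f x : ℂ) := Complex.continuous_ofReal.comp f.continuous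
  simp only [fourierInv_one_sub_cos_mul_fourier hfc f.integrable.ofReal hFi] at hmul
  have hr : Integrable (fun ξ => 𝓕⁻ (fun x => (g (f x) : ℂ)) ξ *
      (((1 - Real.cos (2 * Real.pi * ⟪ξ, z⟫) : ℝ) : ℂ) * 𝓕 (fun x => (f x : ℂ)) ξ)) :=
    hmi.bdd_mul (continuous_fourierInv_of_integrable hgi).aestronglyMeasurable
      (.of_forall (norm_fourierInv_le_integral_norm _))
  have hre := congrArg Complex.re hmul
  have e1 : (∫ x, (g (f x) : ℂ) * ((f x : ℂ) - ((f (x + z) : ℂ) + (f (x - z) : ℂ)) / 2))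
      = ((∫ x, g (f x) * (f x - (f (x + z) + f (x - z)) / 2) : ℝ) : ℂ) := by
    rw [← integral_complex_ofReal]
    push_cast
    rfl
  rw [e1, Complex.ofReal_re, ← RCLike.re_eq_complex_re, ← integral_re hr] at hre
  rw [hre] at h
  refine h.trans (le_of_eq (integral_congr_ae (.of_forall fun ξ => ?_)))
  simp only [RCLike.re_eq_complex_re]
  rw [mul_left_comm, Complex.re_ofReal_mul]

lemma integral_integral_mul_nonneg {T : Type*} [MeasurableSpace T] {μ : Measure T} [SFinite μ]
    {k : T → V → ℝ} {H : V → ℝ}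
    (hint : Integrable (Function.uncurry fun t ξ => k t ξ * H ξ) (μ.prod volume))
    (h : ∀ᵐ t ∂μ, 0 ≤ ∫ ξ, k t ξ * H ξ) :
    0 ≤ ∫ ξ, (∫ t, k t ξ ∂μ) * H ξ := by
  have := integral_integral_swap hint
  simp only [integral_mul_const] at this
  rw [← this]
  exact integral_nonneg_of_ae h

lemma integral_cos_inner_stdGaussian (v : V) :
    ∫ y, Real.cos ⟪y, v⟫ ∂(ProbabilityTheory.stdGaussian V) = Real.exp (-‖v‖ ^ 2 / 2) := by
  have h := ProbabilityTheory.charFun_stdGaussian v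
  rw [charFun_apply] at h
  have hi : Integrable (fun y : V => Complex.exp (⟪y, v⟫ * I))
      (ProbabilityTheory.stdGaussian V) :=
    Integrable.of_bound (Continuous.aestronglyMeasurable (by fun_prop)) 1
      (.of_forall fun y => (Complex.norm_exp_ofReal_mul_I _).le)
  have hre := congrArg Complex.re h
  rw [← RCLike.re_eq_complex_re, ← integral_re hi] at hre
  simp only [RCLike.re_eq_complex_re, Complex.exp_ofReal_mul_I_re] at hre
  rw [hre]
  norm_cast

lemma integral_one_sub_exp_mul_nonneg {H : V → ℝ} (hH : Integrable H)
    (hcos : ∀ z : V, 0 ≤ ∫ ξ, (1 - Real.cos (2 * Real.pi * ⟪ξ, z⟫)) * H ξ) {t : ℝ} (ht : 0 ≤ t) :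
    0 ≤ ∫ ξ, (1 - Real.exp (-(t * ‖ξ‖ ^ 2))) * H ξ := by
  set μ := ProbabilityTheory.stdGaussian V
  have hk (ξ : V) : ∫ y, (1 - Real.cos ⟪y, √(2 * t) • ξ⟫) ∂μ = 1 - Real.exp (-(t * ‖ξ‖ ^ 2)) := by
    rw [integral_sub (integrable_const _), integral_cos_inner_stdGaussian]
    · simp only [integral_const, probReal_univ, one_smul, norm_smul, mul_pow, Real.norm_eq_abs,
        sq_abs, Real.sq_sqrt (mul_nonneg zero_le_two ht)]
      ring_nf
    · exact Integrable.of_bound (Continuous.aestronglyMeasurable (by fun_prop)) 1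
        (.of_forall fun y => Real.abs_cos_le_one _)
  simp_rw [← hk]
  refine integral_integral_mul_nonneg ?_ (.of_forall fun y => ?_)
  · have h2 : Integrable (fun p : V × V => H p.2) (μ.prod volume) := hH.comp_snd μ
    refine h2.bdd_mul (c := 2) (f := fun p : V × V => 1 - Real.cos ⟪p.1, √(2 * t) • p.2⟫)
      (Continuous.aestronglyMeasurable (by fun_prop)) (.of_forall fun p => ?_)
    rw [Real.norm_eq_abs, abs_le]
    constructor <;> linarith [Real.neg_one_le_cos ⟪p.1, √(2 * t) • p.2⟫,
      Real.cos_le_one ⟪p.1, √(2 * t) • p.2⟫]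
  · have h := hcos ((√(2 * t) / (2 * Real.pi)) • y)
    have e (ξ : V) : 2 * Real.pi * ⟪ξ, (√(2 * t) / (2 * Real.pi)) • y⟫ = ⟪y, √(2 * t) • ξ⟫ := by
      rw [inner_smul_right, inner_smul_right, real_inner_comm]
      field_simp
    simpa only [e] using h

lemma integrableOn_one_sub_exp_mul_rpow {α : ℝ} (hα0 : 0 < α) (hα1 : α < 1) :
    IntegrableOn (fun t : ℝ => (1 - Real.exp (-t)) * t ^ (-1 - α)) (Set.Ioi 0) := by
  have hm : Measurable (fun t : ℝ => (1 - Real.exp (-t)) * t ^ (-1 - α)) := by fun_prop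
  rw [← Set.Ioc_union_Ioi_eq_Ioi zero_le_one]
  refine IntegrableOn.union ?_ ?_
  · have h1 : IntegrableOn (fun t : ℝ => t ^ (-α)) (Set.Ioc 0 1) :=
      (intervalIntegrable_iff_integrableOn_Ioc_of_le zero_le_one).1
        (intervalIntegral.intervalIntegrable_rpow' (by linarith))
    refine Integrable.mono' h1 hm.aestronglyMeasurable ?_
    filter_upwards [ae_restrict_mem measurableSet_Ioc] with t ht
    have ht0 : 0 < t := ht.1
    have he : Real.exp (-t) ≤ 1 := Real.exp_le_one_iff.2 (by linarith)
    have hs : t ^ (-α) = t * t ^ (-1 - α) := by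
      rw [← Real.rpow_one_add' ht0.le (by linarith)]
      ring_nf
    rw [Real.norm_of_nonneg (mul_nonneg (by linarith) (Real.rpow_nonneg ht0.le _)), hs]
    exact mul_le_mul_of_nonneg_right (by linarith [Real.add_one_le_exp (-t)])
      (Real.rpow_nonneg ht0.le _)
  · refine Integrable.mono' (integrableOn_Ioi_rpow_of_lt (a := -1 - α) (by linarith) one_pos)
      hm.aestronglyMeasurable ?_
    filter_upwards [ae_restrict_mem measurableSet_Ioi] with t ht
    have ht0 : 0 < t := one_pos.trans ht
    have he : Real.exp (-t) ≤ 1 := Real.exp_le_one_iff.2 (by linarith)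
    rw [Real.norm_of_nonneg (mul_nonneg (by linarith) (Real.rpow_nonneg ht0.le _))]
    exact mul_le_of_le_one_left (Real.rpow_nonneg ht0.le _) (by linarith [Real.exp_pos (-t)])

lemma integral_one_sub_exp_mul_rpow_pos {α : ℝ} (hα0 : 0 < α) (hα1 : α < 1) :
    0 < ∫ t in Set.Ioi (0 : ℝ), (1 - Real.exp (-t)) * t ^ (-1 - α) := by
  have hpos : ∀ t ∈ Set.Ioi (0 : ℝ), 0 < (1 - Real.exp (-t)) * t ^ (-1 - α) := fun t ht =>
    mul_pos (sub_pos.2 (Real.exp_lt_one_iff.2 (neg_lt_zero.2 ht))) (Real.rpow_pos_of_pos ht _)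
  rw [setIntegral_pos_iff_support_of_nonneg_ae
    ((ae_restrict_mem measurableSet_Ioi).mono fun t ht => (hpos t ht).le)
    (integrableOn_one_sub_exp_mul_rpow hα0 hα1)]
  have hsub : Set.Ioi (0 : ℝ) ⊆
      Function.support fun t : ℝ => (1 - Real.exp (-t)) * t ^ (-1 - α) :=
    fun t ht => (hpos t ht).ne'
  rw [Set.inter_eq_right.2 hsub]
  simp

lemma one_sub_exp_mul_rpow_eq {α s : ℝ} (hs : 0 < s) {t : ℝ} (ht : t ∈ Set.Ioi (0 : ℝ)) :
    (1 - Real.exp (-(t * s))) * t ^ (-1 - α)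
      = s ^ (1 + α) * ((1 - Real.exp (-(s * t))) * (s * t) ^ (-1 - α)) := by
  have h : s ^ (1 + α) * s ^ (-1 - α) = 1 := by
    rw [← Real.rpow_add hs]
    ring_nf
    exact Real.rpow_zero s
  rw [Real.mul_rpow hs.le (le_of_lt ht), mul_comm t s]
  linear_combination (-(1 - Real.exp (-(s * t))) * t ^ (-1 - α)) * h

lemma integrableOn_one_sub_exp_mul_mul_rpow {α : ℝ} (hα0 : 0 < α) (hα1 : α < 1) {s : ℝ}
    (hs : 0 ≤ s) :
    IntegrableOn (fun t : ℝ => (1 - Real.exp (-(t * s))) * t ^ (-1 - α)) (Set.Ioi 0) := by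
  rcases hs.eq_or_lt with rfl | hs
  · simp
  refine IntegrableOn.congr_fun ?_ (fun t ht => (one_sub_exp_mul_rpow_eq hs ht).symm)
    measurableSet_Ioi
  refine Integrable.const_mul ?_ _
  have := (integrableOn_Ioi_comp_mul_left_iff
    (fun t : ℝ => (1 - Real.exp (-t)) * t ^ (-1 - α)) 0 hs).2
  rw [mul_zero] at this
  exact this (integrableOn_one_sub_exp_mul_rpow hα0 hα1)

lemma integral_one_sub_exp_mul_mul_rpow {α : ℝ} (hα0 : 0 < α) {s : ℝ} (hs : 0 ≤ s) :
    ∫ t in Set.Ioi (0 : ℝ), (1 - Real.exp (-(t * s))) * t ^ (-1 - α)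
      = s ^ α * ∫ t in Set.Ioi (0 : ℝ), (1 - Real.exp (-t)) * t ^ (-1 - α) := by
  rcases hs.eq_or_lt with rfl | hs
  · simp [Real.zero_rpow hα0.ne']
  rw [setIntegral_congr_fun measurableSet_Ioi fun t ht => one_sub_exp_mul_rpow_eq hs ht,
    integral_const_mul,
    integral_comp_mul_left_Ioi (fun t : ℝ => (1 - Real.exp (-t)) * t ^ (-1 - α)) 0 hs, mul_zero,
    Real.rpow_add hs, Real.rpow_one, smul_eq_mul]
  field_simp

lemma integral_norm_rpow_mul_nonneg {α : ℝ} (hα0 : 0 < α) (hα1 : α < 1) {H : V → ℝ}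
    (hHm : AEStronglyMeasurable H) (hH : Integrable fun ξ => ‖ξ‖ ^ (2 * α) * H ξ)
    (hexp : ∀ t : ℝ, 0 ≤ t → 0 ≤ ∫ ξ, (1 - Real.exp (-(t * ‖ξ‖ ^ 2))) * H ξ) :
    0 ≤ ∫ ξ, ‖ξ‖ ^ (2 * α) * H ξ := by
  set K := ∫ t in Set.Ioi (0 : ℝ), (1 - Real.exp (-t)) * t ^ (-1 - α)
  have hKpos : 0 < K := integral_one_sub_exp_mul_rpow_pos hα0 hα1
  have hk (ξ : V) : ∫ t in Set.Ioi (0 : ℝ), (1 - Real.exp (-(t * ‖ξ‖ ^ 2))) * t ^ (-1 - α)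
      = ‖ξ‖ ^ (2 * α) * K := by
    rw [integral_one_sub_exp_mul_mul_rpow hα0 (sq_nonneg _), ← Real.rpow_natCast_mul
      (norm_nonneg ξ), Nat.cast_ofNat]
  suffices h : 0 ≤ ∫ ξ, (‖ξ‖ ^ (2 * α) * K) * H ξ by
    have e : ∫ ξ, (‖ξ‖ ^ (2 * α) * K) * H ξ = K * ∫ ξ, ‖ξ‖ ^ (2 * α) * H ξ := by
      rw [← integral_const_mul]
      congr 1 with ξ
      ring
    rw [e] at h
    exact nonneg_of_mul_nonneg_right h hKpos
  simp_rw [← hk]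
  refine integral_integral_mul_nonneg ?_ ?_
  · rw [integrable_prod_iff']
    · constructor
      · refine .of_forall fun ξ => ?_
        exact Integrable.mul_const
          (integrableOn_one_sub_exp_mul_mul_rpow hα0 hα1 (sq_nonneg ‖ξ‖)) (H ξ)
      · refine (hH.norm.const_mul K).congr (.of_forall fun ξ => ?_)
        simp only [Function.uncurry_apply_pair, norm_mul, integral_mul_const]
        have : ∫ t in Set.Ioi (0 : ℝ), ‖1 - Real.exp (-(t * ‖ξ‖ ^ 2))‖ * ‖t ^ (-1 - α)‖
            = ‖ξ‖ ^ (2 * α) * K := by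
          rw [← hk]
          refine setIntegral_congr_fun measurableSet_Ioi fun t ht => ?_
          have ht0 : 0 < t := ht
          have he : Real.exp (-(t * ‖ξ‖ ^ 2)) ≤ 1 :=
            Real.exp_le_one_iff.2 (neg_nonpos.2 (by positivity))
          rw [Real.norm_of_nonneg (sub_nonneg.2 he),
            Real.norm_of_nonneg (Real.rpow_nonneg ht0.le _)]
        rw [this, Real.norm_of_nonneg (Real.rpow_nonneg (norm_nonneg ξ) _)]
        ring
    · refine AEStronglyMeasurable.mul ?_ hHm.comp_snd
      exact Measurable.aestronglyMeasurable (by fun_prop)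
  · filter_upwards [ae_restrict_mem measurableSet_Ioi] with t ht
    have ht0 : 0 < t := ht
    have e : ∫ ξ, ((1 - Real.exp (-(t * ‖ξ‖ ^ 2))) * t ^ (-1 - α)) * H ξ
        = t ^ (-1 - α) * ∫ ξ, (1 - Real.exp (-(t * ‖ξ‖ ^ 2))) * H ξ := by
      rw [← integral_const_mul]
      congr 1 with ξ
      ring
    rw [e]
    exact mul_nonneg (Real.rpow_nonneg ht0.le _) (hexp t ht0.le)

lemma SchwartzMap.integrable_norm_rpow_mul (F : 𝓢(V, ℂ)) {s : ℝ} (hs0 : 0 ≤ s) (hs2 : s ≤ 2) :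
    Integrable fun ξ => ((‖ξ‖ ^ s : ℝ) : ℂ) * F ξ := by
  refine (F.integrable.norm.add (F.integrable_pow_mul volume 2)).mono' ?_ (.of_forall fun ξ => ?_)
  · exact (Continuous.aestronglyMeasurable (by fun_prop)).mul F.continuous.aestronglyMeasurable
  · have h : ‖ξ‖ ^ s ≤ 1 + ‖ξ‖ ^ 2 := by
      rcases le_total ‖ξ‖ 1 with h1 | h1
      · nlinarith [Real.rpow_le_one (norm_nonneg ξ) h1 hs0, sq_nonneg ‖ξ‖]
      · have := Real.rpow_le_rpow_of_exponent_le h1 hs2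
        rw [Real.rpow_two] at this
        linarith
    rw [norm_mul, Complex.norm_real, Real.norm_of_nonneg (Real.rpow_nonneg (norm_nonneg ξ) s)]
    simp only [Pi.add_apply]
    nlinarith [mul_le_mul_of_nonneg_right h (norm_nonneg (F ξ))]

end Positivity

lemma SchwartzMap.integrable_mul_abs_rpow {d : ℕ} (f : 𝓢(Spc d, ℝ)) {p : ℝ} (hp : 0 ≤ p) :
    Integrable fun x => f x * |f x| ^ p := by
  refine f.integrable.mul_bdd (c := SchwartzMap.seminorm ℝ 0 0 f ^ p)
    (Continuous.aestronglyMeasurable ?_) (.of_forall fun x => ?_)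
  · exact f.continuous.abs.rpow_const fun x => Or.inr hp
  · rw [Real.norm_of_nonneg (Real.rpow_nonneg (abs_nonneg _) _)]
    exact Real.rpow_le_rpow (abs_nonneg _) (SchwartzMap.norm_le_seminorm ℝ f x) hp

lemma integral_mul_abs_rpow_mul_fracLap_nonneg {d : ℕ} {α : ℝ} (hα0 : 0 < α) (hα1 : α < 1)
    {p : ℝ} (hp : 0 ≤ p) (f : 𝓢(Spc d, ℝ)) :
    0 ≤ ∫ x, f x * |f x| ^ p * fracLap α f x := by
  set g : ℝ → ℝ := fun a => a * |a| ^ p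
  set F : 𝓢(Spc d, ℂ) := 𝓕 (SchwartzMap.postcompCLM Complex.ofRealCLM f) with hF
  have hFf : (F : Spc d → ℂ) = 𝓕 (fun x => (f x : ℂ)) := by
    rw [hF, SchwartzMap.fourier_coe]
    rfl
  have hgf : Integrable fun x => g (f x) := f.integrable_mul_abs_rpow hp
  have hgi : Integrable fun x => (g (f x) : ℂ) := hgf.ofReal
  set G := 𝓕⁻ (fun x => (g (f x) : ℂ))
  have hGc : Continuous G := continuous_fourierInv_of_integrable hgi
  have hGb (ξ : Spc d) : ‖G ξ‖ ≤ ∫ x, ‖(g (f x) : ℂ)‖ := norm_fourierInv_le_integral_norm _ ξ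
  have hGF : Integrable fun ξ => (G ξ * F ξ).re :=
    (F.integrable.bdd_mul hGc.aestronglyMeasurable (.of_forall hGb)).re
  have hFa : Integrable fun ξ => ((‖ξ‖ ^ (2 * α) : ℝ) : ℂ) * F ξ :=
    F.integrable_norm_rpow_mul (by linarith) (by linarith)
  have hGFa : Integrable fun ξ => G ξ * (((‖ξ‖ ^ (2 * α) : ℝ) : ℂ) * F ξ) :=
    hFa.bdd_mul hGc.aestronglyMeasurable (.of_forall hGb)
  have hre (ξ : Spc d) : (G ξ * (((‖ξ‖ ^ (2 * α) : ℝ) : ℂ) * F ξ)).re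
      = ‖ξ‖ ^ (2 * α) * (G ξ * F ξ).re := by
    rw [mul_left_comm, Complex.re_ofReal_mul]
  have hcos (z : Spc d) := integral_one_sub_cos_mul_nonneg
    (mul_abs_rpow_sub_mul_sub_nonneg hp) f hgf (hFf ▸ F.integrable) z
  rw [← hFf] at hcos
  have hmain : 0 ≤ ∫ ξ, ‖ξ‖ ^ (2 * α) * (G ξ * F ξ).re :=
    integral_norm_rpow_mul_nonneg hα0 hα1 hGF.aestronglyMeasurable
      (hGFa.re.congr (.of_forall hre))
      fun t ht => integral_one_sub_exp_mul_nonneg hGF hcos ht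
  refine hmain.trans (le_of_eq ?_)
  have hlhs : Integrable fun x =>
      (g (f x) : ℂ) * 𝓕⁻ (fun ξ => ((‖ξ‖ ^ (2 * α) : ℝ) : ℂ) * F ξ) x :=
    hgi.mul_bdd (continuous_fourierInv_of_integrable hFa).aestronglyMeasurable
      (.of_forall (norm_fourierInv_le_integral_norm _))
  have h := congrArg Complex.re (integral_mul_fourierInv_eq hgi hFa)
  rw [← RCLike.re_eq_complex_re, ← integral_re hlhs, ← integral_re hGFa] at h
  simp only [RCLike.re_eq_complex_re, Complex.re_ofReal_mul] at h
  calc ∫ ξ, ‖ξ‖ ^ (2 * α) * (G ξ * F ξ).re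
      = ∫ ξ, (G ξ * (((‖ξ‖ ^ (2 * α) : ℝ) : ℂ) * F ξ)).re := by simp only [hre]
    _ = ∫ x, f x * |f x| ^ p * fracLap α f x := by
      rw [← h, fracLap]
      simp only [fm, ← hFf]
      rfl

/-- A Fourier multiplier with smooth compactly supported symbol preserves the Schwartz class. -/
lemma exists_schwartzMap_eq_fm {d : ℕ} {m : Spc d → ℝ} (hm : ContDiff ℝ (⊤ : ℕ∞) m)
    (hsupp : HasCompactSupport m) (θ : 𝓢(Spc d, ℝ)) :
    ∃ f : 𝓢(Spc d, ℝ), fm (fun ξ => (m ξ : ℂ)) θ = f := by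
  set F : 𝓢(Spc d, ℂ) := 𝓕 (SchwartzMap.postcompCLM Complex.ofRealCLM θ) with hF
  have hFθ : (F : Spc d → ℂ) = 𝓕 (fun x => (θ x : ℂ)) := by
    rw [hF, SchwartzMap.fourier_coe]
    rfl
  have hmF : ContDiff ℝ (⊤ : ℕ∞) (fun ξ => (m ξ : ℂ) * F ξ) :=
    (Complex.ofRealCLM.contDiff.comp hm).mul (F.smooth ⊤)
  have hcF : HasCompactSupport (fun ξ => (m ξ : ℂ) * F ξ) :=
    (hsupp.comp_left (g := Complex.ofReal) Complex.ofReal_zero).mul_right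
  refine ⟨SchwartzMap.postcompCLM Complex.reCLM (𝓕⁻ (hcF.toSchwartzMap hmF)), ?_⟩
  ext x
  rw [SchwartzMap.postcompCLM_apply, SchwartzMap.fourierInv_coe, fm, ← hFθ]
  rfl

lemma LPData.exists_schwartzMap_eq_Δ {d : ℕ} (D : LPData d) (j : ℤ) (θ : 𝓢(Spc d, ℝ)) :
    ∃ f : 𝓢(Spc d, ℝ), D.Δ j θ = f := by
  unfold LPData.Δ
  split_ifs with h1 h0
  · refine exists_schwartzMap_eq_fm D.χ_smooth ?_ θ
    refine HasCompactSupport.intro (isCompact_closedBall (0 : Spc d) 1) fun ξ hξ => D.χ_supp ξ ?_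
    simpa using hξ
  · have hφ : HasCompactSupport D.φ := by
      refine HasCompactSupport.intro (isCompact_closedBall (0 : Spc d) 2) fun ξ hξ => ?_
      by_contra hne
      exact hξ (by simpa using (D.φ_supp ξ hne).2)
    exact exists_schwartzMap_eq_fm (m := fun ξ => D.φ ((2 : ℝ) ^ (-j) • ξ))
      (D.φ_smooth.comp (contDiff_const_smul _)) (hφ.comp_smul (by positivity)) θ
  · exact ⟨0, rfl⟩

/-- positivity (2.9): `∫ f |f|^{q−2} (−Δ)^α f dx ≥ 0` for Schwartz `f`,
and for `f = Δ_j θ` with `θ` Schwartz, for any `j ≥ −1` (including `j = −1`). -/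
theorem statement_11 {d : ℕ} (α : ℝ) (hα0 : 0 < α) (hα1 : α < 1)
    (q : ℝ) (hq2 : 2 ≤ q) :
    (∀ f : SchwartzMap (Spc d) ℝ,
      0 ≤ ∫ x : Spc d, f x * |f x| ^ (q - 2) * fracLap α ⇑f x) ∧
    (∀ (D : LPData d) (j : ℤ), -1 ≤ j → ∀ θ : SchwartzMap (Spc d) ℝ,
      0 ≤ ∫ x : Spc d,
        D.Δ j ⇑θ x * |D.Δ j ⇑θ x| ^ (q - 2) * fracLap α (D.Δ j ⇑θ) x) := by
  refine ⟨fun f => integral_mul_abs_rpow_mul_fracLap_nonneg hα0 hα1 (by linarith) f, ?_⟩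
  intro D j _ θ
  obtain ⟨f, hf⟩ := D.exists_schwartzMap_eq_Δ j θ
  rw [hf]
  exact integral_mul_abs_rpow_mul_fracLap_nonneg hα0 hα1 (by linarith) f
end

section
/- (Estimate of the nonlinear term in the geometric criterion.) Let 0 ≤ β ≤ 1, σ ∈ (0,1), set s = σ + 1 − β, let p = 2^k be an integer power of 2, and let 1 < q, q' satisfy 1/q + 1/q' = 1 with s q' < 2. Let p₁, p̃₂, p₃ satisfy 1/p₁ + 1/p̃₂ + p/p₃ = 1. For a smooth, sufficiently decaying θ on ℝ², define I = ∫_{ℝ²} p.v.∫_{ℝ²} [∇θ(x)·(y/|y|)] [∇^⊥θ(x+y)·∇θ(x)] |y|^{−1−β} dy · |∇^⊥θ(x)|^{p−2} dx and let ξ = ∇^⊥θ/|∇^⊥θ|. Then I ≤ ‖ξ‖_{Ḟ^σ_{p₁,q}} · ‖(I_{sq'}(|∇^⊥θ|^{q'}))^{1/q'}‖_{L^{p̃₂}} · ‖∇^⊥θ‖_{L^{p₃}}^p, where I_a (0 < a < 2) is the Riesz potential of order a on ℝ². -/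
open MeasureTheory Filter Complex
open scoped ENNReal Topology FourierTransform

section HolderInequality

variable {d : ℕ} {f g : Spc d → ℝ≥0∞} {p q r : ℝ≥0∞}

theorem lpNormE_eq_eLpNorm (hp : p ≠ 0) (g : Spc d → ℝ≥0∞) :
    lpNormE p g = eLpNorm g p volume := by
  rw [lpNormE]
  split_ifs with h
  · simp [h, eLpNormEssSup]
  · simp [eLpNorm_eq_lintegral_rpow_enorm_toReal hp h]

theorem lpNormE_top_mul_le (hq : q ≠ 0) (hg : Measurable g) :
    lpNormE q (f * g) ≤ lpNormE ∞ f * lpNormE q g := by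
  by_cases hqt : q = ∞
  · simpa [lpNormE, hqt] using ENNReal.essSup_mul_le f g
  have hq0 : 0 < q.toReal := ENNReal.toReal_pos hq hqt
  simp only [lpNormE, hqt, if_true, if_false]
  calc (∫⁻ x, (f * g) x ^ q.toReal) ^ (1 / q.toReal)
      ≤ (∫⁻ x, essSup f volume ^ q.toReal * g x ^ q.toReal) ^ (1 / q.toReal) := by
        gcongr 1
        refine lintegral_mono_ae ?_
        filter_upwards [ENNReal.ae_le_essSup f] with x hx
        rw [Pi.mul_apply, ENNReal.mul_rpow_of_nonneg _ _ hq0.le]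
        gcongr
    _ = essSup f volume * (∫⁻ x, g x ^ q.toReal) ^ (1 / q.toReal) := by
        rw [lintegral_const_mul _ (hg.pow_const _),
          ENNReal.mul_rpow_of_nonneg _ _ (by positivity), ← ENNReal.rpow_mul,
          mul_one_div_cancel hq0.ne', ENNReal.rpow_one]

theorem lpNormE_mul_le (hp : p ≠ 0) (hq : q ≠ 0) (hr : r ≠ 0) (hpqr : r⁻¹ = p⁻¹ + q⁻¹)
    (hf : Measurable f) (hg : Measurable g) :
    lpNormE r (f * g) ≤ lpNormE p f * lpNormE q g := by
  by_cases hpt : p = ∞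
  · obtain rfl : r = q := by simpa [hpt] using hpqr
    subst hpt
    exact lpNormE_top_mul_le hq hg
  by_cases hqt : q = ∞
  · obtain rfl : r = p := by simpa [hqt] using hpqr
    subst hqt
    rw [mul_comm f, mul_comm (lpNormE _ _)]
    exact lpNormE_top_mul_le hp hf
  have hrt : r ≠ ∞ := by
    rintro rfl
    simp [eq_comm (a := (0 : ℝ≥0∞)), hpt] at hpqr
  have hp0 := ENNReal.toReal_pos hp hpt
  have hq0 := ENNReal.toReal_pos hq hqt
  have hr0 := ENNReal.toReal_pos hr hrt
  have h : 1 / r.toReal = 1 / p.toReal + 1 / q.toReal := by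
    have := congrArg ENNReal.toReal hpqr
    rw [ENNReal.toReal_add (by simpa using hp) (by simpa using hq)] at this
    simpa using this
  simp only [lpNormE, hpt, hqt, hrt, if_false]
  refine ENNReal.lintegral_Lp_mul_le_Lq_mul_Lr hr0 ?_ h volume hf.aemeasurable hg.aemeasurable
  refine lt_of_one_div_lt_one_div hp0 ?_
  rw [h]
  exact lt_add_of_pos_right _ (by positivity)

theorem lintegral_mul_mul_le_lpNormE {h : Spc d → ℝ≥0∞} (hpqr : p⁻¹ + q⁻¹ + r⁻¹ = 1)
    (hf : Measurable f) (hg : Measurable g) (hh : Measurable h) :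
    ∫⁻ x, f x * g x * h x ≤ lpNormE p f * lpNormE q g * lpNormE r h := by
  have hp : p ≠ 0 := by rintro rfl; simp at hpqr
  have hq : q ≠ 0 := by rintro rfl; simp at hpqr
  have hr : r ≠ 0 := by rintro rfl; simp at hpqr
  have hpq : (p⁻¹ + q⁻¹)⁻¹ ≠ 0 := by simp [hp, hq]
  calc ∫⁻ x, f x * g x * h x = lpNormE 1 (f * g * h) := by simp [lpNormE]
    _ ≤ lpNormE (p⁻¹ + q⁻¹)⁻¹ (f * g) * lpNormE r h :=
        lpNormE_mul_le hpq hr one_ne_zero (by simp [hpqr]) (hf.mul hg) hh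
    _ ≤ lpNormE p f * lpNormE q g * lpNormE r h := by
        gcongr
        exact lpNormE_mul_le hp hq hpq (by simp) hf hg

theorem lpNormE_enorm_pow {E : Type*} [NormedAddCommGroup E] (F : Spc d → E) {n : ℕ}
    (hn : n ≠ 0) (hp : p ≠ 0) :
    lpNormE (p / n) (fun x => ‖F x‖ₑ ^ n) = eLpNorm F p volume ^ n := by
  have hn' : (n : ℝ≥0∞) ≠ 0 := by exact_mod_cast hn
  rw [lpNormE_eq_eLpNorm (by simp [hp])]
  have h := eLpNorm_enorm_rpow (μ := volume) (p := p / n) (q := (n : ℝ)) F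
    (by exact_mod_cast Nat.pos_of_ne_zero hn)
  rw [ENNReal.ofReal_natCast, ENNReal.div_mul_cancel hn' (by simp)] at h
  simpa using h

end HolderInequality

/-- The gradient of a scalar function on `ℝ²`, as a vector. -/
noncomputable def gradVec (f : Spc 2 → ℝ) (x : Spc 2) : Spc 2 :=
  WithLp.toLp 2 ![pd 0 f x, pd 1 f x]

section Gradient

variable (f : Spc 2 → ℝ)

theorem sum_pd_mul (x y : Spc 2) : ∑ i, pd i f x * y i = inner ℝ y (gradVec f x) := by
  simp [gradVec, PiLp.inner_apply, Fin.sum_univ_two]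

theorem sum_mul_pd (x v : Spc 2) : ∑ i, v i * pd i f x = inner ℝ v (gradVec f x) := by
  simp [← sum_pd_mul, mul_comm]

theorem norm_gradVec (x : Spc 2) : ‖gradVec f x‖ = ‖pgrad f x‖ := by
  simp [gradVec, pgrad, EuclideanSpace.norm_eq, Fin.sum_univ_two, add_comm]

theorem inner_pgrad_gradVec (x : Spc 2) : inner ℝ (pgrad f x) (gradVec f x) = 0 := by
  simp [← sum_mul_pd, pgrad, Fin.sum_univ_two]
  ring

theorem norm_smul_dirField (x : Spc 2) : ‖pgrad f x‖ • dirField f x = pgrad f x := by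
  rcases eq_or_ne (pgrad f x) 0 with h | h
  · simp [h]
  · simp [dirField, smul_smul, h]

theorem abs_inner_pgrad_le_sub (x z : Spc 2) :
    |inner ℝ (pgrad f z) (gradVec f x)| ≤ ‖pgrad f z - pgrad f x‖ * ‖pgrad f x‖ := by
  have h : inner ℝ (pgrad f z) (gradVec f x) =
      inner ℝ (pgrad f z - pgrad f x) (gradVec f x) := by
    rw [inner_sub_left, inner_pgrad_gradVec, sub_zero]
  rw [h, ← norm_gradVec f x]
  exact abs_real_inner_le_norm _ _

theorem abs_inner_pgrad_le_dirField (x z : Spc 2) :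
    |inner ℝ (pgrad f z) (gradVec f x)| ≤
      ‖pgrad f z‖ * ‖dirField f z - dirField f x‖ * ‖pgrad f x‖ := by
  have h0 : inner ℝ (dirField f x) (gradVec f x) = 0 := by
    rw [dirField, real_inner_smul_left, inner_pgrad_gradVec, mul_zero]
  have h : inner ℝ (pgrad f z) (gradVec f x) =
      ‖pgrad f z‖ * inner ℝ (dirField f z - dirField f x) (gradVec f x) := by
    rw [inner_sub_left, h0, sub_zero, ← real_inner_smul_left, norm_smul_dirField]
  rw [h, abs_mul, abs_norm, ← norm_gradVec f x, mul_assoc]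
  gcongr
  exact abs_real_inner_le_norm _ _

/-- The integrand of the singular integral, as a function of the displacement `y`. -/
noncomputable def alignKernel (β : ℝ) (x y : Spc 2) : ℝ :=
  ((∑ i, pd i f x * y i) / ‖y‖) * (∑ i, pgrad f (x + y) i * pd i f x) / ‖y‖ ^ (1 + β)

theorem abs_alignKernel_le (β : ℝ) (x y : Spc 2) :
    |alignKernel f β x y| ≤
      ‖pgrad f x‖ * |inner ℝ (pgrad f (x + y)) (gradVec f x)| / ‖y‖ ^ (1 + β) := by
  rw [alignKernel, sum_pd_mul, sum_mul_pd, abs_div, abs_mul, abs_div, abs_norm,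
    abs_of_nonneg (Real.rpow_nonneg (norm_nonneg y) _)]
  gcongr
  refine div_le_of_le_mul₀ (norm_nonneg _) (norm_nonneg _) ?_
  rw [← norm_gradVec, mul_comm]
  exact abs_real_inner_le_norm _ _

theorem abs_alignKernel_le_dirField (β : ℝ) (x y : Spc 2) :
    |alignKernel f β x y| ≤ ‖pgrad f x‖ ^ 2 *
      (‖dirField f (x + y) - dirField f x‖ * ‖pgrad f (x + y)‖ / ‖y‖ ^ (1 + β)) := by
  refine (abs_alignKernel_le f β x y).trans ?_
  rw [← mul_div_assoc]
  gcongr ?_ / _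
  calc _ ≤ ‖pgrad f x‖ * (‖pgrad f (x + y)‖ * ‖dirField f (x + y) - dirField f x‖ *
        ‖pgrad f x‖) := by
        gcongr
        exact abs_inner_pgrad_le_dirField f x (x + y)
    _ = _ := by ring

end Gradient

theorem integrable_indicator_norm_rpow_neg {β : ℝ} (hβ : β ≤ 1) :
    Integrable (fun y : Spc 2 => (Set.Iio (1 : ℝ)).indicator (fun r => r ^ (-β)) ‖y‖) := by
  rw [integrable_fun_norm_addHaar volume
    (f := (Set.Iio (1 : ℝ)).indicator (fun r => r ^ (-β)))]
  have hI : IntegrableOn ((Set.Ioo (0 : ℝ) 1).indicator (fun _ => (1 : ℝ))) (Set.Ioi 0) :=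
    ((integrable_indicator_iff measurableSet_Ioo).2 (by simp)).integrableOn
  refine Integrable.mono' hI ?_ ?_
  · refine Measurable.aestronglyMeasurable ?_
    exact (measurable_id.pow_const _).smul
      ((measurable_id.pow_const _).indicator measurableSet_Iio)
  · filter_upwards [ae_restrict_mem measurableSet_Ioi] with r hr
    have hr : 0 < r := hr
    by_cases h1 : r < 1
    · have hle : r ^ (1 - β) ≤ 1 := Real.rpow_le_one hr.le h1.le (by linarith)
      rw [sub_eq_add_neg, Real.rpow_add hr, Real.rpow_one] at hle
      have hb : 0 < r ^ (-β) := by positivity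
      simpa [h1, hr, abs_of_pos hb, abs_of_pos hr] using hle
    · simp [h1]

section Schwartz

variable (θ : SchwartzMap (Spc 2) ℝ)

open LineDeriv in
theorem exists_schwartz_pgrad :
    ∃ G : Fin 2 → SchwartzMap (Spc 2) ℝ, ∀ x,
      pgrad θ x = WithLp.toLp 2 (fun i => G i x) := by
  refine ⟨![-∂_{EuclideanSpace.single (1 : Fin 2) (1 : ℝ)} θ,
    ∂_{EuclideanSpace.single (0 : Fin 2) (1 : ℝ)} θ],
    fun x => ?_⟩
  ext i
  fin_cases i <;> simp [pgrad, pd, SchwartzMap.lineDerivOp_apply_eq_fderiv]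

theorem continuous_pgrad : Continuous (pgrad θ) := by
  obtain ⟨G, hG⟩ := exists_schwartz_pgrad θ
  rw [funext hG]
  exact (PiLp.continuous_toLp 2 _).comp (continuous_pi fun i => (G i).continuous)

theorem integrable_pgrad : Integrable (pgrad θ) := by
  obtain ⟨G, hG⟩ := exists_schwartz_pgrad θ
  refine Integrable.mono' ((G 0).integrable.norm.add (G 1).integrable.norm)
    (continuous_pgrad θ).aestronglyMeasurable (ae_of_all _ fun x => ?_)
  rw [hG, EuclideanSpace.norm_eq, Fin.sum_univ_two]
  simp only [Pi.add_apply]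
  refine Real.sqrt_le_iff.2 ⟨by positivity, ?_⟩
  nlinarith [norm_nonneg (G 0 x), norm_nonneg (G 1 x)]

theorem exists_lipschitz_schwartz (g : SchwartzMap (Spc 2) ℝ) :
    ∃ C : ℝ, 0 ≤ C ∧ ∀ x y, ‖g x - g y‖ ≤ C * ‖x - y‖ := by
  obtain ⟨C, hC, h⟩ := (SchwartzMap.fderivCLM ℝ (Spc 2) ℝ g).decay 0 0
  refine ⟨C, hC.le, fun x y => ?_⟩
  refine Convex.norm_image_sub_le_of_norm_fderiv_le (𝕜 := ℝ) (s := Set.univ)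
    (fun z _ => g.differentiableAt) (fun z _ => ?_) convex_univ trivial trivial
  simpa using h z

theorem exists_lipschitz_pgrad :
    ∃ C : ℝ, 0 ≤ C ∧ ∀ x y, ‖pgrad θ x - pgrad θ y‖ ≤ C * ‖x - y‖ := by
  obtain ⟨G, hG⟩ := exists_schwartz_pgrad θ
  obtain ⟨C₀, h₀, H₀⟩ := exists_lipschitz_schwartz (G 0)
  obtain ⟨C₁, h₁, H₁⟩ := exists_lipschitz_schwartz (G 1)
  refine ⟨C₀ + C₁, by positivity, fun x y => ?_⟩
  have : ‖pgrad θ x - pgrad θ y‖ ≤ ‖G 0 x - G 0 y‖ + ‖G 1 x - G 1 y‖ := by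
    rw [hG, hG, EuclideanSpace.norm_eq, Fin.sum_univ_two]
    refine Real.sqrt_le_iff.2 ⟨by positivity, ?_⟩
    simp only [PiLp.sub_apply]
    nlinarith [norm_nonneg (G 0 x - G 0 y), norm_nonneg (G 1 x - G 1 y)]
  linarith [H₀ x y, H₁ x y]

theorem measurable_dirField : Measurable (dirField θ) := by
  have := (continuous_pgrad θ).measurable
  exact this.norm.inv.smul this

theorem measurable_alignKernel (β : ℝ) (x : Spc 2) : Measurable (alignKernel θ β x) := by
  have h := continuous_pgrad θ
  unfold alignKernel
  simp only [sum_pd_mul, sum_mul_pd]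
  have h1 : Measurable fun y : Spc 2 => (inner ℝ y (gradVec θ x) : ℝ) :=
    (by fun_prop : Continuous fun y : Spc 2 => (inner ℝ y (gradVec θ x) : ℝ)).measurable
  have h2 : Measurable fun y : Spc 2 => (inner ℝ (pgrad θ (x + y)) (gradVec θ x) : ℝ) :=
    (by fun_prop : Continuous fun y : Spc 2 =>
      (inner ℝ (pgrad θ (x + y)) (gradVec θ x) : ℝ)).measurable
  exact ((h1.div measurable_norm).mul h2).div (measurable_norm.pow_const _)

theorem integrable_alignKernel {β : ℝ} (hβ0 : 0 ≤ β) (hβ1 : β ≤ 1) (x : Spc 2) :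
    Integrable (alignKernel θ β x) := by
  obtain ⟨C, hC, hL⟩ := exists_lipschitz_pgrad θ
  set a := ‖pgrad θ x‖ with ha
  have hI := ((integrable_indicator_norm_rpow_neg hβ1).const_mul (a * (C * a))).add
    ((((integrable_pgrad θ).comp_add_left x).norm).const_mul (a * a))
  refine Integrable.mono' hI (measurable_alignKernel θ β x).aestronglyMeasurable
    (ae_of_all _ fun y => ?_)
  simp only [Pi.add_apply]
  refine (abs_alignKernel_le θ β x y).trans ?_
  rw [← ha]
  rcases eq_or_ne y 0 with rfl | hy
  · have : (0 : ℝ) ^ (1 + β) = 0 := Real.zero_rpow (by positivity)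
    simp only [norm_zero, this, div_zero]
    refine add_nonneg (mul_nonneg (by positivity) (Set.indicator_apply_nonneg fun _ => ?_))
      (by positivity)
    exact Real.rpow_nonneg le_rfl _
  have hy : 0 < ‖y‖ := norm_pos_iff.2 hy
  by_cases h1 : ‖y‖ < 1
  · rw [Set.indicator_of_mem (show ‖y‖ ∈ Set.Iio (1 : ℝ) from h1)]
    refine le_add_of_le_of_nonneg ?_ (by positivity)
    have h2 := abs_inner_pgrad_le_sub θ x (x + y)
    have h3 := hL (x + y) x
    rw [add_sub_cancel_left] at h3
    rw [Real.rpow_add hy, Real.rpow_one, Real.rpow_neg hy.le]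
    calc _ ≤ a * (C * ‖y‖ * a) / (‖y‖ * ‖y‖ ^ β) := by
          gcongr
          exact h2.trans (by gcongr)
      _ = _ := by field_simp
  · rw [Set.indicator_of_notMem (show ‖y‖ ∉ Set.Iio (1 : ℝ) from h1), mul_zero, zero_add]
    have h2 : |inner ℝ (pgrad θ (x + y)) (gradVec θ x)| ≤ ‖pgrad θ (x + y)‖ * a := by
      rw [ha, ← norm_gradVec θ x]
      exact abs_real_inner_le_norm _ _
    have h3 : 1 ≤ ‖y‖ ^ (1 + β) := Real.one_le_rpow (not_lt.1 h1) (by positivity)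
    refine (div_le_self (by positivity) h3).trans ?_
    calc _ ≤ a * (‖pgrad θ (x + y)‖ * a) := by gcongr
      _ = _ := by ring

end Schwartz

theorem pvIntegral_eq_integral {F : Spc 2 → ℝ} (hF : Integrable F) :
    pvIntegral F = ∫ y, F y := by
  refine Tendsto.limUnder_eq ?_
  have hm (ε : ℝ) : MeasurableSet {y : Spc 2 | ε < ‖y‖} :=
    measurableSet_lt measurable_const measurable_norm
  simp only [← integral_indicator (hm _)]
  refine tendsto_integral_filter_of_dominated_convergence (fun y => ‖F y‖)
    (Eventually.of_forall fun ε => hF.aestronglyMeasurable.indicator (hm ε))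
    (Eventually.of_forall fun ε => ae_of_all _ fun y => norm_indicator_le_norm_self _ _)
    hF.norm ?_
  have h0 : ∀ᵐ y : Spc 2, y ≠ 0 := by simp [ae_iff]
  filter_upwards [h0] with y hy
  refine tendsto_const_nhds.congr' ?_
  filter_upwards [nhdsWithin_le_nhds (Iio_mem_nhds (norm_pos_iff.2 hy))] with ε hε
  rw [Set.indicator_of_mem]
  exact hε

/-- Hölder's inequality in the displacement variable. -/
theorem lintegral_enorm_div_rpow_le {σ β s q q' : ℝ} (hs : s = σ + 1 - β)
    (hq : q.HolderConjugate q') {u v : Spc 2 → ℝ≥0∞}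
    (hu : Measurable u) (hv : Measurable v) :
    ∫⁻ y, u y * v y / ‖y‖ₑ ^ (1 + β) ≤
      (∫⁻ y, u y ^ q / ‖y‖ₑ ^ (2 + σ * q)) ^ (1 / q) *
        (∫⁻ y, v y ^ q' / ‖y‖ₑ ^ (2 - s * q')) ^ (1 / q') := by
  have hq0 := hq.pos
  have hq0' := hq.symm.pos
  have hr (a : ℝ) : Measurable fun y : Spc 2 => ‖y‖ₑ ^ a := measurable_enorm.pow_const a
  have key (a r : ℝ) (hr : 0 < r) (w : Spc 2 → ℝ≥0∞) (y : Spc 2) :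
      (w y / ‖y‖ₑ ^ (a / r)) ^ r = w y ^ r / ‖y‖ₑ ^ a := by
    rw [ENNReal.div_rpow_of_nonneg _ _ hr.le, ← ENNReal.rpow_mul, div_mul_cancel₀ _ hr.ne']
  have H := ENNReal.lintegral_mul_le_Lp_mul_Lq volume hq
    (f := fun y => u y / ‖y‖ₑ ^ ((2 + σ * q) / q))
    (g := fun y => v y / ‖y‖ₑ ^ ((2 - s * q') / q'))
    (hu.div (hr _)).aemeasurable (hv.div (hr _)).aemeasurable
  simp only [key _ _ hq0, key _ _ hq0', Pi.mul_apply] at H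
  refine le_trans (le_of_eq ?_) H
  have h0 : ∀ᵐ y : Spc 2, y ≠ 0 := by simp [ae_iff]
  refine lintegral_congr_ae ?_
  filter_upwards [h0] with y hy
  have hy0 : ‖y‖ₑ ≠ 0 := by simpa using hy
  have he : 1 + β = (2 + σ * q) / q + (2 - s * q') / q' := by
    have := hq.inv_add_inv_eq_one
    field_simp at this ⊢
    rw [hs]
    linear_combination (-2) * this
  rw [he, ENNReal.rpow_add _ _ hy0 (by simp),
    ENNReal.mul_div_mul_comm (Or.inr (by simp [hy0])) (Or.inr (by simp [hy0]))]

/-- estimate of the nonlinear term in the geometric criterion: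
`I ≤ ‖ξ‖_{Ḟ^σ_{p₁,q}} ‖(I_{sq'}(|∇^⊥θ|^{q'}))^{1/q'}‖_{L^{p̃₂}} ‖∇^⊥θ‖_{L^{p₃}}^p`. -/
theorem statement_17 (β σ : ℝ) (hβ0 : 0 ≤ β) (hβ1 : β ≤ 1) (hσ0 : 0 < σ) (hσ1 : σ < 1)
    (s : ℝ) (hσs : s = σ + 1 - β) (k : ℕ) (hk : 0 < k)
    (qe qe' : ℝ) (hqe : 1 < qe) (hqe' : 1 < qe') (hconj : 1 / qe + 1 / qe' = 1)
    (hsq : s * qe' < 2)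
    (p₁ p₂ p₃ : ℝ≥0∞) (hHolder : p₁⁻¹ + p₂⁻¹ + (((2 : ℕ) ^ k : ℕ) : ℝ≥0∞) * p₃⁻¹ = 1)
    (θ : SchwartzMap (Spc 2) ℝ) :
    ENNReal.ofReal (∫ x : Spc 2,
        pvIntegral (fun y =>
          ((∑ i, pd i ⇑θ x * y i) / ‖y‖) *
            (∑ i, pgrad ⇑θ (x + y) i * pd i ⇑θ x) / ‖y‖ ^ (1 + β)) *
          ‖pgrad ⇑θ x‖ ^ ((2 : ℝ) ^ k - 2)) ≤
      tlNorm σ p₁ (ENNReal.ofReal qe) (dirField ⇑θ) *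
        lpNormE p₂ (fun x =>
          (∫⁻ y : Spc 2, (‖pgrad ⇑θ (x + y)‖₊ : ℝ≥0∞) ^ qe' /
              (‖y‖₊ : ℝ≥0∞) ^ (2 - s * qe')) ^ (1 / qe')) *
        eLpNorm (pgrad ⇑θ) p₃ volume ^ ((2 : ℕ) ^ k) := by
  have hq : qe.HolderConjugate qe' := by
    rw [Real.holderConjugate_iff]
    exact ⟨hqe, by simpa using hconj⟩
  have hqt : (ENNReal.ofReal qe).toReal = qe := ENNReal.toReal_ofReal (by linarith)
  have hn : 2 ^ k ≠ 0 := by positivity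
  have hp₃ : p₃ ≠ 0 := by
    rintro rfl
    simp at hHolder
  have hG := (continuous_pgrad θ).measurable
  have hξ := measurable_dirField θ
  have hadd : Measurable fun z : Spc 2 × Spc 2 => z.1 + z.2 := measurable_add
  rw [← lpNormE_enorm_pow (pgrad θ) hn hp₃, tlNorm]
  simp only [ENNReal.ofReal_ne_top, if_false, hqt, ← enorm_eq_nnnorm]
  set A : Spc 2 → ℝ≥0∞ := fun x =>
    (∫⁻ y, ‖dirField θ (x + y) - dirField θ x‖ₑ ^ qe / ‖y‖ₑ ^ (2 + σ * qe)) ^ (1 / qe)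
  set B : Spc 2 → ℝ≥0∞ := fun x =>
    (∫⁻ y, ‖pgrad θ (x + y)‖ₑ ^ qe' / ‖y‖ₑ ^ (2 - s * qe')) ^ (1 / qe')
  have hAm : Measurable A := by
    refine (Measurable.lintegral_prod_right' (f := fun z : Spc 2 × Spc 2 =>
      ‖dirField θ (z.1 + z.2) - dirField θ z.1‖ₑ ^ qe / ‖z.2‖ₑ ^ (2 + σ * qe)) ?_).pow_const _
    exact (((hξ.comp hadd).sub (hξ.comp measurable_fst)).enorm.pow_const _).div
      (measurable_snd.enorm.pow_const _)
  have hBm : Measurable B := by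
    refine (Measurable.lintegral_prod_right' (f := fun z : Spc 2 × Spc 2 =>
      ‖pgrad θ (z.1 + z.2)‖ₑ ^ qe' / ‖z.2‖ₑ ^ (2 - s * qe')) ?_).pow_const _
    exact ((hG.comp hadd).enorm.pow_const _).div (measurable_snd.enorm.pow_const _)
  refine le_trans ?_ (lintegral_mul_mul_le_lpNormE ?_ hAm hBm (hG.enorm.pow_const _))
  swap
  · rw [ENNReal.inv_div (by simp) (by simp), ENNReal.div_eq_inv_mul, mul_comm p₃⁻¹]
    exact hHolder
  refine (ENNReal.ofReal_le_ofReal (Real.le_norm_self _)).trans ?_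
  rw [ofReal_norm]
  refine (enorm_integral_le_lintegral_enorm _).trans (lintegral_mono fun x => ?_)
  change ‖pvIntegral (alignKernel θ β x) * _‖ₑ ≤ _
  rw [pvIntegral_eq_integral (integrable_alignKernel θ hβ0 hβ1 x), enorm_mul]
  have hker : ‖∫ y, alignKernel θ β x y‖ₑ ≤ ‖pgrad θ x‖ₑ ^ 2 * (A x * B x) := by
    refine (enorm_integral_le_lintegral_enorm _).trans ?_
    have hu : Measurable fun y => ‖dirField θ (x + y) - dirField θ x‖ₑ :=
      ((hξ.comp (measurable_const_add x)).sub measurable_const).enorm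
    have hv : Measurable fun y => ‖pgrad θ (x + y)‖ₑ := (hG.comp (measurable_const_add x)).enorm
    refine le_trans ?_ (mul_le_mul_right
      (lintegral_enorm_div_rpow_le hσs hq hu hv) (‖pgrad θ x‖ₑ ^ 2))
    have hm : Measurable fun y : Spc 2 =>
        ‖dirField θ (x + y) - dirField θ x‖ₑ * ‖pgrad θ (x + y)‖ₑ / ‖y‖ₑ ^ (1 + β) :=
      (hu.mul hv).div (measurable_enorm.pow_const _)
    rw [← lintegral_const_mul _ hm]
    have h0 : ∀ᵐ y : Spc 2, y ≠ 0 := by simp [ae_iff]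
    refine lintegral_mono_ae ?_
    filter_upwards [h0] with y hy
    have hy : 0 < ‖y‖ := norm_pos_iff.2 hy
    have h := ENNReal.ofReal_le_ofReal (abs_alignKernel_le_dirField θ β x y)
    rwa [ENNReal.ofReal_mul (by positivity), ENNReal.ofReal_div_of_pos (by positivity),
      ENNReal.ofReal_mul (by positivity), ENNReal.ofReal_pow (by positivity),
      ← ENNReal.ofReal_rpow_of_pos hy, ofReal_norm, ofReal_norm, ofReal_norm, ofReal_norm,
      ← Real.norm_eq_abs, ofReal_norm] at h
  have hpow : ‖pgrad θ x‖ₑ ^ 2 * ‖‖pgrad θ x‖ ^ ((2 : ℝ) ^ k - 2)‖ₑ = ‖pgrad θ x‖ₑ ^ 2 ^ k := by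
    have h2 : 2 ≤ 2 ^ k := Nat.le_self_pow hk.ne' 2
    have he : (2 : ℝ) ^ k - 2 = ((2 ^ k - 2 : ℕ) : ℝ) := by
      rw [Nat.cast_sub h2]
      norm_num
    rw [he, Real.rpow_natCast, enorm_pow, enorm_norm, ← pow_add, Nat.add_sub_cancel' h2]
  calc _ ≤ ‖pgrad θ x‖ₑ ^ 2 * (A x * B x) * ‖‖pgrad θ x‖ ^ ((2 : ℝ) ^ k - 2)‖ₑ := by gcongr
    _ = A x * B x * ‖pgrad θ x‖ₑ ^ 2 ^ k := by rw [← hpow]; ring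
end
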